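/- arXiv:0807.4423 — 8 statements merged into one kernel-verified Lean document; each statement's English description precedes it below -/
import Mathlib

section
/- Closed-form Lagrange multipliers under Assumption 2 (equation (9)): Assume A_i A_j = 0 for all i ≠ j. Let G ∈ S^n, Y ∈ ℝ^{n×p}, and λ ∈ ℝ^m satisfy (G − Σ_{i=1}^m λ_i A_i) Y = 0, and suppose Tr(Yᵀ A_j² Y) ≠ 0 for every j. Then for each j, λ_j = Tr(Yᵀ A_j G Y) / Tr(Yᵀ A_j² Y). -/
open Matrix BigOperators

/-- Closed-form Lagrange multipliers under Assumption 2
(equation (9)). -/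
theorem closed_form_multipliers {n p m : ℕ}
    (A : Fin m → Matrix (Fin n) (Fin n) ℝ)
    (hA : ∀ i, (A i).IsSymm)
    (hA2 : ∀ i j, i ≠ j → A i * A j = 0)
    (G : Matrix (Fin n) (Fin n) ℝ) (hG : G.IsSymm)
    (Y : Matrix (Fin n) (Fin p) ℝ)
    (l : Fin m → ℝ)
    (hKKT : (G - ∑ i, l i • A i) * Y = 0)
    (hnz : ∀ j, (Yᵀ * (A j) ^ 2 * Y).trace ≠ 0) :
    ∀ j, l j = (Yᵀ * A j * G * Y).trace / (Yᵀ * (A j) ^ 2 * Y).trace := by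
  intro j
  have hsum : A j * ∑ i, l i • A i = l j • A j ^ 2 := by
    rw [Finset.mul_sum, Finset.sum_eq_single j]
    · rw [Matrix.mul_smul, sq]
    · intro i _ hij
      rw [Matrix.mul_smul, hA2 j i hij.symm, smul_zero]
    · simp
  have hGY : G * Y = (∑ i, l i • A i) * Y := by
    rwa [Matrix.sub_mul, sub_eq_zero] at hKKT
  have key : Yᵀ * A j * G * Y = l j • (Yᵀ * A j ^ 2 * Y) := by
    rw [Matrix.mul_assoc, hGY, ← Matrix.mul_assoc, Matrix.mul_assoc Yᵀ, hsum,
      Matrix.mul_smul, Matrix.smul_mul]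
  rw [key, Matrix.trace_smul, smul_eq_mul, mul_div_cancel_right₀ _ (hnz j)]
end

section
/- Theorem 1, necessity direction: Assume A_i A_j = 0 for all i ≠ j (Assumption 2), and assume there exists a positive definite X̂ ∈ S^n with Tr(A_i X̂) = b_i for all i (Slater's condition). Let Y ∈ ℝ^{n×p} satisfy Tr(Yᵀ A_i Y) = b_i and Tr(Yᵀ A_i² Y) ≠ 0 for all i, and let λ ∈ ℝ^m satisfy (∇f(YYᵀ) − Σ_{i=1}^m λ_i A_i) Y = 0. If X = YYᵀ is a global minimizer of the convex program (P), then the matrix S_Y := ∇f(YYᵀ) − Σ_{i=1}^m λ_i A_i is positive semidefinite. -/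
open Matrix BigOperators

open Filter Topology

/-- A function whose minimum over `[0, 1)` is attained at `0` has nonnegative derivative there. -/
theorem HasDerivAt.nonneg_of_forall_Ioo_le {φ : ℝ → ℝ} {d : ℝ} (h : HasDerivAt φ d 0)
    (hφ : ∀ t ∈ Set.Ioo (0 : ℝ) 1, φ 0 ≤ φ t) : 0 ≤ d := by
  have h1 := (hasDerivWithinAt_iff_tendsto_slope' (by simp)).1 (h.hasDerivWithinAt (s := Set.Ioi 0))
  refine ge_of_tendsto h1 ?_
  filter_upwards [Ioo_mem_nhdsGT (zero_lt_one' ℝ)] with t ht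
  rw [slope_def_field, sub_zero]
  exact div_nonneg (sub_nonneg.2 (hφ t ht)) ht.1.le

/-- The root of `ε α c² + 2 β c + γ` that depends continuously on `ε` near `0`. -/
noncomputable def smallRoot (α β γ ε : ℝ) : ℝ := -γ / (β + √(β ^ 2 - α * ε * γ))

theorem smallRoot_spec {α β γ ε : ℝ} (hβ : 0 < β) (hD : 0 ≤ β ^ 2 - α * ε * γ) :
    ε * α * smallRoot α β γ ε ^ 2 + 2 * β * smallRoot α β γ ε + γ = 0 := by
  have hr := Real.sq_sqrt hD
  have hpos : β + √(β ^ 2 - α * ε * γ) ≠ 0 := by positivity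
  unfold smallRoot
  generalize √(β ^ 2 - α * ε * γ) = r at hr hpos
  field_simp
  linear_combination γ * hr

theorem continuousAt_smallRoot {α β γ : ℝ} (hβ : 0 < β) :
    ContinuousAt (smallRoot α β γ) 0 := by
  have hpos : β + √(β ^ 2 - α * 0 * γ) ≠ 0 := by positivity
  unfold smallRoot
  fun_prop (disch := exact hpos)

namespace Matrix

variable {n p m : ℕ}

theorem trace_transpose_mul_sq_mul_pos {A : Matrix (Fin n) (Fin n) ℝ} (hA : A.IsSymm)
    {Y : Matrix (Fin n) (Fin p) ℝ} (h : (Yᵀ * A ^ 2 * Y).trace ≠ 0) :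
    0 < (Yᵀ * A ^ 2 * Y).trace := by
  have h1 : Yᵀ * A ^ 2 * Y = (A * Y)ᴴ * (A * Y) := by
    simp [conjTranspose_eq_transpose_of_trivial, transpose_mul, hA.eq, pow_two, Matrix.mul_assoc]
  exact lt_of_le_of_ne (h1 ▸ (posSemidef_conjTranspose_mul_self (A * Y)).trace_nonneg) h.symm

theorem mul_sum_smul_of_mul_eq_zero {A : Fin m → Matrix (Fin n) (Fin n) ℝ}
    (hA2 : ∀ i j, i ≠ j → A i * A j = 0) (c : Fin m → ℝ) (i : Fin m) :
    A i * ∑ j, c j • A j = c i • A i ^ 2 := by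
  rw [Finset.mul_sum, Finset.sum_eq_single i]
  · simp [pow_two]
  · intro j _ hj
    simp [hA2 i j hj.symm]
  · simp

/-- Perturbing `Y` along the directions `A j * Y` affects the `i`-th quadratic form only through
the `i`-th coefficient. -/
theorem trace_mul_perturbation {A : Fin m → Matrix (Fin n) (Fin n) ℝ}
    (hA : ∀ i, (A i).IsSymm) (hA2 : ∀ i j, i ≠ j → A i * A j = 0)
    (Y : Matrix (Fin n) (Fin p) ℝ) (c : Fin m → ℝ) (ε : ℝ) (i : Fin m) :
    (A i * ((Y + ε • ((∑ j, c j • A j) * Y)) * (Y + ε • ((∑ j, c j • A j) * Y))ᵀ)).trace =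
      (Yᵀ * A i * Y).trace + 2 * (ε * c i) * (Yᵀ * A i ^ 2 * Y).trace +
        (ε * c i) ^ 2 * (Yᵀ * A i ^ 3 * Y).trace := by
  have hB := mul_sum_smul_of_mul_eq_zero hA2 c i
  have hBs : (∑ j, c j • A j)ᵀ = ∑ j, c j • A j := by
    simp [transpose_sum, (hA _).eq]
  generalize ∑ j, c j • A j = B at hB hBs
  have hB' : B * A i = c i • A i ^ 2 := by
    simpa [hBs, (hA i).eq] using congrArg transpose hB
  have hBB : B * A i * B = c i ^ 2 • A i ^ 3 := by
    rw [hB', smul_mul_assoc, pow_two, mul_assoc, hB, mul_smul_comm, smul_smul]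
    congr 1
    · ring
    · rw [← pow_succ']
  have key : (Y + ε • (B * Y))ᵀ * A i * (Y + ε • (B * Y)) =
      Yᵀ * A i * Y + ε • (Yᵀ * (A i * B) * Y) + ε • (Yᵀ * (B * A i) * Y) +
        (ε * ε) • (Yᵀ * (B * A i * B) * Y) := by
    simp only [transpose_add, transpose_smul, transpose_mul, hBs, Matrix.add_mul, Matrix.mul_add,
      Matrix.smul_mul, Matrix.mul_smul, Matrix.mul_assoc]
    module
  rw [← Matrix.mul_assoc, trace_mul_comm, ← Matrix.mul_assoc, key, hBB, hB, hB']
  simp only [trace_add, trace_smul, Matrix.mul_smul, Matrix.smul_mul, smul_eq_mul]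
  ring

/-- First-order optimality over the feasible set, expressed through a multiplier matrix that
annihilates the minimizer. -/
theorem trace_dual_mul_nonneg {A : Fin m → Matrix (Fin n) (Fin n) ℝ} {b : Fin m → ℝ}
    {f : Matrix (Fin n) (Fin n) ℝ → ℝ} {G X : Matrix (Fin n) (Fin n) ℝ}
    (hgrad : ∀ H : Matrix (Fin n) (Fin n) ℝ,
      HasDerivAt (fun t : ℝ => f (X + t • H)) ((G * H).trace) 0)
    (hX : X.PosSemidef) (hXb : ∀ i, (A i * X).trace = b i)
    {l : Fin m → ℝ} (hl : ((G - ∑ i, l i • A i) * X).trace = 0)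
    (hmin : ∀ X' : Matrix (Fin n) (Fin n) ℝ, X'.PosSemidef →
      (∀ i, (A i * X').trace = b i) → f X ≤ f X')
    {X' : Matrix (Fin n) (Fin n) ℝ} (hX' : X'.PosSemidef) (hX'b : ∀ i, (A i * X').trace = b i) :
    0 ≤ ((G - ∑ i, l i • A i) * X').trace := by
  have h := (hgrad (X' - X)).nonneg_of_forall_Ioo_le fun t ht => by
    have hconv : X + t • (X' - X) = (1 - t) • X + t • X' := by module
    simp only [zero_smul, add_zero, hconv]
    refine hmin _ ((hX.smul (sub_nonneg.2 ht.2.le)).add (hX'.smul ht.1.le)) fun i => ?_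
    simp only [Matrix.mul_add, Matrix.mul_smul, trace_add, trace_smul, hXb, hX'b, smul_eq_mul]
    ring
  have hsum : ((∑ i, l i • A i) * (X' - X)).trace = 0 := by
    simp [Matrix.sum_mul, trace_sum, Matrix.mul_sub, trace_sub, hXb, hX'b]
  have hsplit : ((G - ∑ i, l i • A i) * X').trace = (G * (X' - X)).trace -
      ((∑ i, l i • A i) * (X' - X)).trace + ((G - ∑ i, l i • A i) * X).trace := by
    simp only [Matrix.sub_mul, Matrix.mul_sub, trace_sub]
    ring
  rw [hsplit, hsum, hl]
  linarith

theorem trace_mul_vecMulVec_self (M : Matrix (Fin n) (Fin n) ℝ) (u : Fin n → ℝ) :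
    (M * vecMulVec u u).trace = u ⬝ᵥ M *ᵥ u := by
  rw [mul_vecMulVec, trace_vecMulVec, dotProduct_comm]

end Matrix

/-- Theorem 1, necessity direction: under Assumption 2 and
Slater's condition, if `X = YYᵀ` is a global minimizer of the convex program
(P), then the dual matrix `S_Y = ∇f(YYᵀ) − Σ λ_i A_i` is positive
semidefinite. -/
theorem global_min_implies_dual_psd {n p m : ℕ}
    (A : Fin m → Matrix (Fin n) (Fin n) ℝ) (b : Fin m → ℝ)
    (hA : ∀ i, (A i).IsSymm)
    (hA2 : ∀ i j, i ≠ j → A i * A j = 0)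
    (f : Matrix (Fin n) (Fin n) ℝ → ℝ)
    (g : Matrix (Fin n) (Fin n) ℝ → Matrix (Fin n) (Fin n) ℝ)
    (hf_conv : ConvexOn ℝ Set.univ f)
    (hg_symm : ∀ X : Matrix (Fin n) (Fin n) ℝ, X.IsSymm → (g X).IsSymm)
    (hgrad : ∀ X H : Matrix (Fin n) (Fin n) ℝ,
      HasDerivAt (fun t : ℝ => f (X + t • H)) ((g X * H).trace) 0)
    (Xhat : Matrix (Fin n) (Fin n) ℝ)
    (hXhat_pd : Xhat.PosDef)
    (hXhat_feas : ∀ i, (A i * Xhat).trace = b i)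
    (Y : Matrix (Fin n) (Fin p) ℝ)
    (hfeas : ∀ i, (Yᵀ * A i * Y).trace = b i)
    (hnz : ∀ i, (Yᵀ * (A i) ^ 2 * Y).trace ≠ 0)
    (l : Fin m → ℝ)
    (hl : (g (Y * Yᵀ) - ∑ i, l i • A i) * Y = 0)
    (hmin : ∀ X' : Matrix (Fin n) (Fin n) ℝ, X'.PosSemidef →
      (∀ i, (A i * X').trace = b i) → f (Y * Yᵀ) ≤ f X') :
    (g (Y * Yᵀ) - ∑ i, l i • A i).PosSemidef := by
  set S := g (Y * Yᵀ) - ∑ i, l i • A i with hS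
  have hXpsd : (Y * Yᵀ).PosSemidef := by
    simpa [conjTranspose_eq_transpose_of_trivial] using posSemidef_self_mul_conjTranspose Y
  have hSsymm : Sᵀ = S := by
    have hG : (g (Y * Yᵀ))ᵀ = g (Y * Yᵀ) := hg_symm _ (by simp [IsSymm])
    simp [hS, transpose_sum, (hA _).eq, hG]
  have hYS : Yᵀ * S = 0 := by
    simpa [hSsymm] using congrArg transpose hl
  refine .of_dotProduct_mulVec_nonneg hSsymm fun u => ?_
  rw [star_trivial]
  by_contra! hu
  have hβ i := trace_transpose_mul_sq_mul_pos (hA i) (hnz i)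
  let c (ε : ℝ) (i : Fin m) : ℝ :=
    smallRoot (Yᵀ * A i ^ 3 * Y).trace (Yᵀ * A i ^ 2 * Y).trace (u ⬝ᵥ A i *ᵥ u) ε
  let Q (c : Fin m → ℝ) : ℝ :=
    (S * (((∑ j, c j • A j) * Y) * ((∑ j, c j • A j) * Y)ᵀ)).trace
  have hQ : Continuous Q := by fun_prop
  have hc : ContinuousAt c 0 := continuousAt_pi.2 fun i => continuousAt_smallRoot (hβ i)
  have hneg : ∀ᶠ ε in 𝓝 (0 : ℝ), u ⬝ᵥ S *ᵥ u + ε * Q (c ε) < 0 := by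
    have hcont : ContinuousAt (fun ε => u ⬝ᵥ S *ᵥ u + ε * Q (c ε)) 0 :=
      continuousAt_const.add (continuousAt_id.mul (hQ.continuousAt.comp hc))
    exact hcont.eventually_lt continuousAt_const (by simpa using hu)
  have hdisc : ∀ᶠ ε in 𝓝 (0 : ℝ), ∀ i,
      0 < (Yᵀ * A i ^ 2 * Y).trace ^ 2 - (Yᵀ * A i ^ 3 * Y).trace * ε * (u ⬝ᵥ A i *ᵥ u) := by
    refine eventually_all.2 fun i => ?_
    refine continuousAt_const.eventually_lt (by fun_prop) ?_
    simpa using pow_pos (hβ i) 2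
  obtain ⟨ε, ⟨hεneg, hεdisc⟩, hε⟩ :=
    (((hneg.and hdisc).filter_mono nhdsWithin_le_nhds).and
      (self_mem_nhdsWithin (s := Set.Ioi (0 : ℝ)))).exists
  set K := (∑ j, c ε j • A j) * Y with hK
  have hW : ((Y + ε • K) * (Y + ε • K)ᵀ).PosSemidef := by
    simpa [conjTranspose_eq_transpose_of_trivial] using
      posSemidef_self_mul_conjTranspose (Y + ε • K)
  have huu : (vecMulVec u u).PosSemidef := by
    simpa using posSemidef_vecMulVec_self_star u
  have hopt := trace_dual_mul_nonneg (hgrad (Y * Yᵀ)) hXpsd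
    (fun i => by rw [← Matrix.mul_assoc, trace_mul_comm, ← Matrix.mul_assoc, hfeas])
    (by rw [← Matrix.mul_assoc, hl, Matrix.zero_mul, trace_zero]) hmin
    (hW.add (huu.smul hε.le)) (fun i => by
      rw [Matrix.mul_add, trace_add, Matrix.mul_smul, trace_smul, trace_mul_vecMulVec_self,
        trace_mul_perturbation hA hA2, hfeas, smul_eq_mul]
      linear_combination ε * smallRoot_spec (hβ i) (hεdisc i).le)
  have hSW : (S * ((Y + ε • K) * (Y + ε • K)ᵀ)).trace = ε ^ 2 * Q (c ε) := by
    have hSY : (S * (K * Yᵀ)).trace = 0 := by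
      rw [← Matrix.mul_assoc, trace_mul_comm, ← Matrix.mul_assoc, hYS, Matrix.zero_mul, trace_zero]
    rw [← Matrix.mul_assoc, Matrix.mul_add, hl, zero_add, Matrix.mul_smul, Matrix.smul_mul,
      transpose_add, Matrix.mul_add, trace_smul, trace_add, Matrix.mul_assoc, hSY, transpose_smul,
      Matrix.mul_smul, trace_smul, Matrix.mul_assoc, zero_add, smul_eq_mul, smul_eq_mul]
    ring
  rw [← hS, Matrix.mul_add, trace_add, hSW, Matrix.mul_smul, trace_smul, trace_mul_vecMulVec_self,
    smul_eq_mul] at hopt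
  nlinarith [mul_neg_of_pos_of_neg hε hεneg]
end

section
/- Lemma 4 (second derivative of the Lagrangian dominates the dual-matrix quadratic form): Let f : S^n → ℝ be convex and twice continuously differentiable with gradient ∇f(X) ∈ S^n. Fix Y ∈ ℝ^{n×p}, λ ∈ ℝ^m, and Z ∈ ℝ^{n×p}, set S_Y := ∇f(YYᵀ) − Σ_{i=1}^m λ_i A_i, and let φ(t) = f((Y+tZ)(Y+tZ)ᵀ) − Σ_{i=1}^m λ_i Tr((Y+tZ)ᵀ A_i (Y+tZ)). Then (1/2)·φ''(0) = Tr(Zᵀ S_Y Z) + α with α ≥ 0; moreover, if Y Zᵀ = 0 then α = 0, i.e. (1/2)·φ''(0) = Tr(Zᵀ S_Y Z). -/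
open Matrix BigOperators

attribute [local instance] Matrix.normedAddCommGroup Matrix.normedSpace

/-- The second derivative of a `C²` function along the parabola `t ↦ X + t • W + t ^ 2 • V`,
after subtraction of a quadratic polynomial. -/
theorem iteratedDeriv_two_comp_parabola_sub {E : Type*} [NormedAddCommGroup E] [NormedSpace ℝ E]
    {f : E → ℝ} (hf : ContDiff ℝ 2 f) (X W V : E) (a b c : ℝ) :
    iteratedDeriv 2 (fun t : ℝ => f (X + t • W + t ^ 2 • V) - (a + t * b + t ^ 2 * c)) 0
      = fderiv ℝ (fderiv ℝ f) X W W + 2 * fderiv ℝ f X V - 2 * c := by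
  have hcurve (t : ℝ) :
      HasDerivAt (fun t : ℝ => X + t • W + t ^ 2 • V) (W + (2 * t) • V) t := by
    have h := (((hasDerivAt_id t).smul_const W).const_add X).add
      ((hasDerivAt_pow 2 t).smul_const V)
    exact h.congr_deriv (by simp)
  have hquad (t : ℝ) : HasDerivAt (fun t : ℝ => a + t * b + t ^ 2 * c) (b + 2 * t * c) t := by
    have h := (((hasDerivAt_id t).mul_const b).const_add a).add
      ((hasDerivAt_pow 2 t).mul_const c)
    exact h.congr_deriv (by simp)
  have hderiv : deriv (fun t : ℝ => f (X + t • W + t ^ 2 • V) - (a + t * b + t ^ 2 * c))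
      = fun t => fderiv ℝ f (X + t • W + t ^ 2 • V) (W + (2 * t) • V) - (b + 2 * t * c) := by
    funext t
    have hfd : HasFDerivAt f (fderiv ℝ f (X + t • W + t ^ 2 • V)) (X + t • W + t ^ 2 • V) :=
      (hf.differentiable two_ne_zero _).hasFDerivAt
    exact ((hfd.comp_hasDerivAt t (hcurve t)).sub (hquad t)).deriv
  have hff : HasFDerivAt (fderiv ℝ f) (fderiv ℝ (fderiv ℝ f) X)
      (X + (0 : ℝ) • W + (0 : ℝ) ^ 2 • V) := by
    simpa using ((hf.fderiv_right (m := 1) one_add_one_eq_two.le).differentiable one_ne_zero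
      X).hasFDerivAt
  have hdir : HasDerivAt (fun t : ℝ => W + (2 * t) • V) ((2 : ℝ) • V) 0 := by
    simpa using (((hasDerivAt_id (0 : ℝ)).const_mul 2).smul_const V).const_add W
  have hlin : HasDerivAt (fun t : ℝ => b + 2 * t * c) (2 * c) 0 := by
    simpa using (((hasDerivAt_id (0 : ℝ)).const_mul 2).mul_const c).const_add b
  have hcomp : HasDerivAt (fun t : ℝ => fderiv ℝ f (X + t • W + t ^ 2 • V))
      (fderiv ℝ (fderiv ℝ f) X W) 0 :=
    (hff.comp_hasDerivAt (0 : ℝ) (hcurve 0)).congr_deriv (by simp)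
  rw [iteratedDeriv_succ, iteratedDeriv_one, hderiv]
  exact ((hcomp.clm_apply hdir).sub hlin).deriv.trans (by simp)

/-- The Hessian of a convex `C²` function is positive semidefinite. -/
theorem ConvexOn.fderiv_fderiv_apply_self_nonneg {E : Type*} [NormedAddCommGroup E]
    [NormedSpace ℝ E] {f : E → ℝ} (hconv : ConvexOn ℝ Set.univ f) (hf : ContDiff ℝ 2 f)
    (X W : E) : 0 ≤ fderiv ℝ (fderiv ℝ f) X W W := by
  have hline (t : ℝ) : HasDerivAt (fun t : ℝ => X + t • W) W t := by
    simpa using ((hasDerivAt_id t).smul_const W).const_add X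
  have hderiv (t : ℝ) : HasDerivAt (fun t : ℝ => f (X + t • W)) (fderiv ℝ f (X + t • W) W) t :=
    (hf.differentiable two_ne_zero (X + t • W)).hasFDerivAt.comp_hasDerivAt t (hline t)
  have hconvLine : ConvexOn ℝ Set.univ (fun t : ℝ => f (X + t • W)) := by
    refine ⟨convex_univ, fun x _ y _ a b ha hb hab => ?_⟩
    have h := hconv.2 (Set.mem_univ (X + x • W)) (Set.mem_univ (X + y • W)) ha hb hab
    have hpt : X + (a • x + b • y) • W = a • (X + x • W) + b • (X + y • W) := by
      obtain rfl : b = 1 - a := by linarith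
      simp only [smul_eq_mul]
      module
    simpa only [hpt] using h
  have hmono : Monotone (fun t : ℝ => fderiv ℝ f (X + t • W) W) := by
    have h := hconvLine.monotoneOn_deriv (fun t _ => (hderiv t).differentiableAt)
    rw [funext fun t => (hderiv t).deriv] at h
    exact monotoneOn_univ.mp h
  have hff : HasFDerivAt (fderiv ℝ f) (fderiv ℝ (fderiv ℝ f) X) (X + (0 : ℝ) • W) := by
    simpa using ((hf.fderiv_right (m := 1) one_add_one_eq_two.le).differentiable one_ne_zero
      X).hasFDerivAt
  have hcomp : HasDerivAt (fun t : ℝ => fderiv ℝ f (X + t • W))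
      (fderiv ℝ (fderiv ℝ f) X W) 0 :=
    hff.comp_hasDerivAt (0 : ℝ) (hline 0)
  have hval : deriv (fun t : ℝ => fderiv ℝ f (X + t • W) W) 0
      = fderiv ℝ (fderiv ℝ f) X W W := by
    simpa using (hcomp.clm_apply (hasDerivAt_const (0 : ℝ) W)).deriv
  rw [← hval]
  exact hmono.deriv_nonneg

/-- Half the second derivative of a convex `C²` function along the parabola
`t ↦ X + t • W + t ^ 2 • V`, after subtraction of a quadratic polynomial, is the derivative
in the direction `V` minus the quadratic coefficient, up to a nonnegative curvature term that
vanishes with `W`. -/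
theorem ConvexOn.exists_half_iteratedDeriv_two_parabola_sub_eq {E : Type*}
    [NormedAddCommGroup E] [NormedSpace ℝ E] {f : E → ℝ} (hconv : ConvexOn ℝ Set.univ f)
    (hf : ContDiff ℝ 2 f) (X W V : E) (a b c : ℝ) {d : ℝ}
    (hd : HasDerivAt (fun t : ℝ => f (X + t • V)) d 0) :
    ∃ α : ℝ, 0 ≤ α ∧
      (1 / 2) * iteratedDeriv 2
          (fun t : ℝ => f (X + t • W + t ^ 2 • V) - (a + t * b + t ^ 2 * c)) 0 = d - c + α ∧
      (W = 0 → α = 0) := by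
  have hdir : fderiv ℝ f X V = d := by
    rw [← (hf.differentiable two_ne_zero X).lineDeriv_eq_fderiv]
    exact HasLineDerivAt.lineDeriv hd
  refine ⟨1 / 2 * fderiv ℝ (fderiv ℝ f) X W W, ?_, ?_, fun hW => by simp [hW]⟩
  · have := hconv.fderiv_fderiv_apply_self_nonneg hf X W
    positivity
  · rw [iteratedDeriv_two_comp_parabola_sub hf, hdir]
    ring

/-- Lemma 4: one half of the second derivative of the Lagrangian
along the direction `Z` equals `Tr(Zᵀ S_Y Z) + α` with `α ≥ 0`, and `α = 0`
whenever `Y Zᵀ = 0`. -/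
theorem lagrangian_second_derivative_decomposition {n p m : ℕ}
    (A : Fin m → Matrix (Fin n) (Fin n) ℝ)
    (hA : ∀ i, (A i).IsSymm)
    (f : Matrix (Fin n) (Fin n) ℝ → ℝ)
    (g : Matrix (Fin n) (Fin n) ℝ → Matrix (Fin n) (Fin n) ℝ)
    (hf_conv : ConvexOn ℝ Set.univ f)
    (hf : ContDiff ℝ 2 f)
    (hg_symm : ∀ X : Matrix (Fin n) (Fin n) ℝ, X.IsSymm → (g X).IsSymm)
    (hgrad : ∀ X H : Matrix (Fin n) (Fin n) ℝ,
      HasDerivAt (fun t : ℝ => f (X + t • H)) ((g X * H).trace) 0)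
    (Y : Matrix (Fin n) (Fin p) ℝ) (l : Fin m → ℝ)
    (Z : Matrix (Fin n) (Fin p) ℝ) :
    ∃ α : ℝ, 0 ≤ α ∧
      (1 / 2) * iteratedDeriv 2 (fun t : ℝ =>
          f ((Y + t • Z) * (Y + t • Z)ᵀ)
            - ∑ i, l i * ((Y + t • Z)ᵀ * A i * (Y + t • Z)).trace) 0
        = (Zᵀ * (g (Y * Yᵀ) - ∑ i, l i • A i) * Z).trace + α ∧
      (Y * Zᵀ = 0 → α = 0) := by
  set X := Y * Yᵀ with hX
  set W := Y * Zᵀ + Z * Yᵀ with hW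
  have hcurve (t : ℝ) : (Y + t • Z) * (Y + t • Z)ᵀ = X + t • W + t ^ 2 • (Z * Zᵀ) := by
    simp only [hX, hW, transpose_add, transpose_smul, Matrix.add_mul, Matrix.mul_add,
      Matrix.smul_mul, Matrix.mul_smul]
    module
  have hquad (t : ℝ) : ∑ i, l i * ((Y + t • Z)ᵀ * A i * (Y + t • Z)).trace
      = (∑ i, l i * (Yᵀ * A i * Y).trace)
        + t * (∑ i, l i * ((Yᵀ * A i * Z).trace + (Zᵀ * A i * Y).trace))
        + t ^ 2 * ∑ i, l i * (Zᵀ * A i * Z).trace := by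
    simp only [Finset.mul_sum, ← Finset.sum_add_distrib]
    refine Finset.sum_congr rfl fun i _ => ?_
    simp only [transpose_add, transpose_smul, Matrix.add_mul, Matrix.mul_add,
      Matrix.smul_mul, Matrix.mul_smul, trace_add, trace_smul, smul_eq_mul]
    ring
  have htrace : (Zᵀ * (g X - ∑ i, l i • A i) * Z).trace
      = (Zᵀ * g X * Z).trace - ∑ i, l i * (Zᵀ * A i * Z).trace := by
    simp [Matrix.mul_sub, Matrix.sub_mul, Matrix.mul_sum, Matrix.sum_mul, trace_sum]
  have hgradTrace : (g X * (Z * Zᵀ)).trace = (Zᵀ * g X * Z).trace := by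
    rw [← Matrix.mul_assoc, trace_mul_comm, Matrix.mul_assoc]
  obtain ⟨α, hα, heq, hzero⟩ := hf_conv.exists_half_iteratedDeriv_two_parabola_sub_eq hf X W
    (Z * Zᵀ) (∑ i, l i * (Yᵀ * A i * Y).trace)
    (∑ i, l i * ((Yᵀ * A i * Z).trace + (Zᵀ * A i * Y).trace))
    (∑ i, l i * (Zᵀ * A i * Z).trace) (hgrad X (Z * Zᵀ))
  refine ⟨α, hα, ?_, fun hYZ => hzero ?_⟩
  · simp only [hcurve, hquad]
    rw [htrace, ← hgradTrace]
    exact heq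
  · have hZY : Z * Yᵀ = 0 := by simpa using congrArg transpose hYZ
    rw [hW, hYZ, hZY, add_zero]
end

section
/- Theorem 2: Let f : S^n → ℝ be convex and twice continuously differentiable with gradient ∇f(X) ∈ S^n. Suppose Y ∈ ℝ^{n×p} is a local minimizer of Y' ↦ f(Y'Y'ᵀ) on {Y' : Tr(Y'ᵀ A_i Y') = b_i, i = 1,…,m}, the matrices A_1 Y, …, A_m Y are linearly independent, and Y is rank deficient, i.e. rank(Y) < p. Then X = YYᵀ is a global minimizer of the convex program (P): f(X') ≥ f(YYᵀ) for every X' ⪰ 0 with Tr(A_i X') = b_i for all i. -/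
open Matrix BigOperators

attribute [local instance] Matrix.normedAddCommGroup Matrix.normedSpace

open Filter Topology

section RankDeficientLocalMin

variable {n p ι : Type*} [Fintype n] [Fintype p] [Fintype ι]

/-- The derivative of the Gram map `Y ↦ Y * Yᵀ` at `Y`. -/
noncomputable def gramDeriv (Y : Matrix n p ℝ) : Matrix n p ℝ →L[ℝ] Matrix n n ℝ :=
  LinearMap.toContinuousLinearMap
    { toFun := fun H => H * Yᵀ + Y * Hᵀ
      map_add' := fun H K => by simp [Matrix.add_mul, Matrix.mul_add]; abel
      map_smul' := fun c H => by simp }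

theorem gramDeriv_apply (Y H : Matrix n p ℝ) : gramDeriv Y H = H * Yᵀ + Y * Hᵀ := rfl

theorem hasStrictFDerivAt_gram (Y : Matrix n p ℝ) :
    HasStrictFDerivAt (fun Y : Matrix n p ℝ => Y * Yᵀ) (gramDeriv Y) Y := by
  let B : Matrix n p ℝ →L[ℝ] Matrix n p ℝ →L[ℝ] Matrix n n ℝ :=
    (LinearMap.mk₂ ℝ (fun Y Z : Matrix n p ℝ => Y * Zᵀ)
      (fun _ _ _ => by simp [Matrix.add_mul]) (fun _ _ _ => by simp)
      (fun _ _ _ => by simp [Matrix.mul_add]) (fun _ _ _ => by simp)).toContinuousBilinearMap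
  have h := B.hasStrictFDerivAt_of_bilinear (hasStrictFDerivAt_id Y) (hasStrictFDerivAt_id Y)
  refine h.congr_fderiv ?_
  ext1 H
  exact add_comm (Y * Hᵀ) (H * Yᵀ)

/-- The linear functional `X ↦ Tr (A X)`. -/
noncomputable def traceMulLeft (A : Matrix n n ℝ) : Matrix n n ℝ →L[ℝ] ℝ :=
  LinearMap.toContinuousLinearMap
    { toFun := fun X => (A * X).trace
      map_add' := fun X Z => by simp [Matrix.mul_add]
      map_smul' := fun c X => by simp }

theorem traceMulLeft_apply (A X : Matrix n n ℝ) : traceMulLeft A X = (A * X).trace := rfl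

theorem trace_mul_gramDeriv {A : Matrix n n ℝ} (hA : A.IsSymm) (Y H : Matrix n p ℝ) :
    (A * gramDeriv Y H).trace = 2 * ((A * Y)ᵀ * H).trace := by
  have h1 : (A * (H * Yᵀ)).trace = ((A * Y)ᵀ * H).trace := by
    rw [← Matrix.mul_assoc, Matrix.trace_mul_comm, Matrix.transpose_mul, hA.eq, Matrix.mul_assoc]
  have h2 : (A * (Y * Hᵀ)).trace = ((A * Y)ᵀ * H).trace := by
    rw [← Matrix.mul_assoc, ← Matrix.trace_transpose, Matrix.transpose_mul,
      Matrix.transpose_transpose, Matrix.trace_mul_comm]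
  rw [gramDeriv_apply, Matrix.mul_add, Matrix.trace_add, h1, h2, two_mul]

theorem trace_transpose_mul_mul_eq (A : Matrix n n ℝ) (Y : Matrix n p ℝ) :
    (Yᵀ * A * Y).trace = (A * (Y * Yᵀ)).trace := by
  rw [Matrix.mul_assoc, Matrix.trace_mul_comm, Matrix.mul_assoc]

/-- Linear combinations of the constraint normals `A i * Y`. -/
noncomputable def normalComb (A : ι → Matrix n n ℝ) (Y : Matrix n p ℝ) :
    (ι → ℝ) →L[ℝ] Matrix n p ℝ :=
  LinearMap.toContinuousLinearMap (Fintype.linearCombination ℝ fun i => A i * Y)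

theorem normalComb_apply {q : Type*} (A : ι → Matrix n n ℝ) (Y : Matrix n q ℝ) (c : ι → ℝ) :
    normalComb A Y c = ∑ i, c i • (A i * Y) := rfl

theorem sum_mul_apply_add_eq_zero {E : Type*} [NormedAddCommGroup E] [NormedSpace ℝ E]
    {F : ι → StrongDual ℝ E} {F₀ : StrongDual ℝ E} {c : ι → ℝ} {c₀ : ℝ}
    (h : ∑ i, c i • F i + c₀ • F₀ = 0) (x : E) : ∑ i, c i * F i x + c₀ * F₀ x = 0 := by
  simpa using DFunLike.congr_fun h x

/-- First-order optimality: under the constraint qualification there are multipliers `μ`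
with `(G + ∑ i, μ i • A i) * Y = 0`, where `G` is the gradient of `f` at `Y * Yᵀ`. -/
theorem exists_multipliers_of_isLocalMinOn
    {A : ι → Matrix n n ℝ} (hA : ∀ i, (A i).IsSymm) {f : Matrix n n ℝ → ℝ} {G : Matrix n n ℝ}
    (hG : G.IsSymm) {Y : Matrix n p ℝ} (hf : HasStrictFDerivAt f (traceMulLeft G) (Y * Yᵀ))
    (hmin : IsLocalMinOn (fun Z : Matrix n p ℝ => f (Z * Zᵀ))
      {Z | ∀ i, (A i * (Z * Zᵀ)).trace = (A i * (Y * Yᵀ)).trace} Y)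
    (hindep : LinearIndependent ℝ fun i => A i * Y) :
    ∃ μ : ι → ℝ, (G + ∑ i, μ i • A i) * Y = 0 := by
  have hq : ∀ i, HasStrictFDerivAt (fun Z : Matrix n p ℝ => (A i * (Z * Zᵀ)).trace)
      ((traceMulLeft (A i)).comp (gramDeriv Y)) Y := fun i =>
    (traceMulLeft (A i)).hasStrictFDerivAt.comp Y (hasStrictFDerivAt_gram Y)
  have hφ : HasStrictFDerivAt (fun Z : Matrix n p ℝ => f (Z * Zᵀ))
      ((traceMulLeft G).comp (gramDeriv Y)) Y :=
    HasStrictFDerivAt.comp Y hf (hasStrictFDerivAt_gram Y)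
  obtain ⟨Λ, Λ₀, hne, hsum⟩ :=
    IsLocalExtrOn.exists_multipliers_of_hasStrictFDerivAt (Or.inl hmin) hq hφ
  have hK : normalComb A Y Λ + Λ₀ • (G * Y) = 0 := by
    rw [← Matrix.transpose_eq_zero, Matrix.ext_iff_trace_mul_right]
    intro H
    have h : ∑ i, Λ i * (A i * gramDeriv Y H).trace + Λ₀ * (G * gramDeriv Y H).trace = 0 :=
      sum_mul_apply_add_eq_zero hsum H
    simp only [trace_mul_gramDeriv (hA _), trace_mul_gramDeriv hG] at h
    simp only [normalComb_apply, Matrix.transpose_add, Matrix.transpose_sum,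
      Matrix.transpose_smul, Matrix.add_mul, Matrix.sum_mul, Matrix.smul_mul, Matrix.trace_add,
      Matrix.trace_sum, Matrix.trace_smul, smul_eq_mul, Matrix.zero_mul, Matrix.trace_zero]
    simp only [mul_left_comm _ (2 : ℝ), ← Finset.mul_sum, ← mul_add] at h
    linarith
  have hΛ₀ : Λ₀ ≠ 0 := by
    rintro rfl
    rw [zero_smul, add_zero, normalComb_apply] at hK
    exact hne (Prod.ext (funext (Fintype.linearIndependent_iff.1 hindep Λ hK)) rfl)
  refine ⟨fun i => Λ₀⁻¹ * Λ i, ?_⟩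
  have h := congrArg (fun M => Λ₀⁻¹ • M) hK
  simpa [normalComb_apply, smul_add, Finset.smul_sum, smul_smul, hΛ₀, Matrix.add_mul,
    Matrix.sum_mul, add_comm] using h

/-- The values of the constraints along the normal directions at `Y` form a local
diffeomorphism, so they can be prescribed to first order. -/
theorem exists_normal_curve {A : ι → Matrix n n ℝ} (hA : ∀ i, (A i).IsSymm)
    {Y : Matrix n p ℝ} (hindep : LinearIndependent ℝ fun i => A i * Y) (a : ι → ℝ) :
    ∃ (c : ℝ → ι → ℝ) (c' : ι → ℝ), c 0 = 0 ∧ HasDerivAt c c' 0 ∧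
      (∀ i, 2 * ((A i * Y)ᵀ * normalComb A Y c').trace = -a i) ∧
      ∀ᶠ s in 𝓝 (0 : ℝ), ∀ i, (A i * ((Y + normalComb A Y (c s)) *
        (Y + normalComb A Y (c s))ᵀ)).trace = (A i * (Y * Yᵀ)).trace - s * a i := by
  let Q : Matrix n n ℝ →L[ℝ] (ι → ℝ) := ContinuousLinearMap.pi fun i => traceMulLeft (A i)
  let L : (ι → ℝ) →L[ℝ] (ι → ℝ) := Q.comp ((gramDeriv Y).comp (normalComb A Y))
  have hL : ∀ c i, L c i = 2 * ((A i * Y)ᵀ * normalComb A Y c).trace := fun c i =>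
    trace_mul_gramDeriv (hA i) Y _
  have hinj : Function.Injective L := by
    refine (injective_iff_map_eq_zero L).2 fun c hc => ?_
    have h0 : ∀ i, ((A i * Y)ᵀ * normalComb A Y c).trace = 0 := fun i => by
      have := hL c i
      rw [hc, Pi.zero_apply] at this
      linarith
    have hW : normalComb A Y c = 0 := by
      rw [← Matrix.trace_conjTranspose_mul_self_eq_zero_iff, Matrix.conjTranspose_eq_transpose_of_trivial]
      conv_lhs => enter [1, 1]; rw [normalComb_apply]
      simp only [Matrix.transpose_sum, Matrix.transpose_smul, Matrix.sum_mul, Matrix.smul_mul,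
        Matrix.trace_sum, Matrix.trace_smul, h0, smul_zero, Finset.sum_const_zero]
    exact funext (Fintype.linearIndependent_iff.1 hindep c hW)
  let e : (ι → ℝ) ≃L[ℝ] (ι → ℝ) :=
    (LinearEquiv.ofInjectiveEndo (L : (ι → ℝ) →ₗ[ℝ] (ι → ℝ)) hinj).toContinuousLinearEquiv
  have he : (e : (ι → ℝ) →L[ℝ] (ι → ℝ)) = L := by ext1; rfl
  let Φ : (ι → ℝ) → ι → ℝ := fun c =>
    Q ((Y + normalComb A Y c) * (Y + normalComb A Y c)ᵀ)
  have hΦ : HasStrictFDerivAt Φ (e : (ι → ℝ) →L[ℝ] (ι → ℝ)) 0 := by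
    rw [he]
    have h1 : HasStrictFDerivAt (fun c => Y + normalComb A Y c) (normalComb A Y) 0 :=
      (normalComb A Y).hasStrictFDerivAt.const_add Y
    have h2 : HasStrictFDerivAt (fun Z : Matrix n p ℝ => Z * Zᵀ) (gramDeriv Y)
        (Y + normalComb A Y 0) := by
      simpa using hasStrictFDerivAt_gram Y
    exact Q.hasStrictFDerivAt.comp 0 (h2.comp 0 h1)
  have hΦ0 : Φ 0 = Q (Y * Yᵀ) := by simp [Φ]
  have hline : HasDerivAt (fun s : ℝ => Φ 0 - s • a) (-a) 0 := by
    simpa using ((hasDerivAt_id (0 : ℝ)).smul_const a).const_sub (Φ 0)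
  have hinv := hΦ.to_localInverse.hasFDerivAt
  refine ⟨fun s => hΦ.localInverse Φ e 0 (Φ 0 - s • a), e.symm (-a), ?_, ?_, fun i => ?_, ?_⟩
  · simp
  · exact HasFDerivAt.comp_hasDerivAt_of_eq 0 hinv hline (by simp)
  · rw [← hL, ← he]
    simp
  · have ht : Tendsto (fun s : ℝ => Φ 0 - s • a) (𝓝 0) (𝓝 (Φ 0)) := by
      simpa using hline.continuousAt.tendsto
    filter_upwards [ht.eventually hΦ.eventually_right_inverse] with s hs i
    have := congrFun hs i
    rw [hΦ0] at this
    rw [hΦ0]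
    exact this

/-- Second-order optimality at a rank deficient point: the dual slack matrix is positive
semidefinite. -/
theorem posSemidef_of_isLocalMinOn
    {A : ι → Matrix n n ℝ} (hA : ∀ i, (A i).IsSymm) {f : Matrix n n ℝ → ℝ} {G : Matrix n n ℝ}
    (hG : G.IsSymm) {Y : Matrix n p ℝ} (hf : HasFDerivAt f (traceMulLeft G) (Y * Yᵀ))
    (hmin : IsLocalMinOn (fun Z : Matrix n p ℝ => f (Z * Zᵀ))
      {Z | ∀ i, (A i * (Z * Zᵀ)).trace = (A i * (Y * Yᵀ)).trace} Y)
    (hindep : LinearIndependent ℝ fun i => A i * Y)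
    {w : p → ℝ} (hw : w ≠ 0) (hYw : Y *ᵥ w = 0)
    {μ : ι → ℝ} (hμ : (G + ∑ i, μ i • A i) * Y = 0) :
    (G + ∑ i, μ i • A i).PosSemidef := by
  have hS : (G + ∑ i, μ i • A i).IsSymm := by
    simp [Matrix.IsSymm, Matrix.transpose_sum, hG.eq, (hA _).eq]
  refine Matrix.PosSemidef.of_dotProduct_mulVec_nonneg
    (by rwa [Matrix.IsHermitian, Matrix.conjTranspose_eq_transpose_of_trivial]) fun z => ?_
  set V : Matrix n p ℝ := Matrix.vecMulVec z w with hV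
  obtain ⟨c, c', hc0, hc, hc', hfeas⟩ :=
    exists_normal_curve hA hindep fun i => (A i * (V * Vᵀ)).trace
  have hYV : Y * Vᵀ = 0 := by
    rw [hV, Matrix.transpose_vecMulVec, Matrix.mul_vecMulVec, hYw, Matrix.zero_vecMulVec]
  have hWV : ∀ d, normalComb A Y d * Vᵀ = 0 := fun d => by
    simp [normalComb_apply, Matrix.sum_mul, Matrix.mul_assoc, hYV]
  have hgram : ∀ d (s : ℝ), 0 ≤ s →
      (Y + normalComb A Y d + √s • V) * (Y + normalComb A Y d + √s • V)ᵀ =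
        (Y + normalComb A Y d) * (Y + normalComb A Y d)ᵀ + s • (V * Vᵀ) := fun d s hs => by
    have h1 : (Y + normalComb A Y d) * Vᵀ = 0 := by rw [Matrix.add_mul, hYV, hWV, add_zero]
    have h2 : V * (Y + normalComb A Y d)ᵀ = 0 := by
      simpa using congrArg Matrix.transpose h1
    generalize Y + normalComb A Y d = Z at h1 h2 ⊢
    simp [Matrix.add_mul, Matrix.mul_add, h1, h2, smul_smul, Real.mul_self_sqrt hs]
  let X : ℝ → Matrix n n ℝ := fun s =>
    (Y + normalComb A Y (c s)) * (Y + normalComb A Y (c s))ᵀ + s • (V * Vᵀ)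
  have hX0 : X 0 = Y * Yᵀ := by simp [X, hc0]
  have hX : HasDerivAt X (gramDeriv Y (normalComb A Y c') + V * Vᵀ) 0 := by
    have h1 : HasDerivAt (fun s => Y + normalComb A Y (c s)) (normalComb A Y c') 0 :=
      ((normalComb A Y).hasFDerivAt.comp_hasDerivAt 0 hc).const_add Y
    have h2 := HasFDerivAt.comp_hasDerivAt_of_eq 0 (hasStrictFDerivAt_gram Y).hasFDerivAt h1
      (by simp [hc0])
    have h3 : HasDerivAt (fun s : ℝ => s • (V * Vᵀ)) (V * Vᵀ) 0 :=
      ((hasDerivAt_id (0 : ℝ)).smul_const (V * Vᵀ)).congr_deriv (one_smul ℝ _)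
    exact h2.add h3
  have hfX := HasFDerivAt.comp_hasDerivAt_of_eq 0 hf hX hX0.symm
  have hcurve : Tendsto (fun s => Y + normalComb A Y (c s) + √s • V) (𝓝 0) (𝓝 Y) := by
    have h1 : ContinuousAt (fun s => Y + normalComb A Y (c s) + √s • V) 0 :=
      ((continuousAt_const.add ((normalComb A Y).continuous.continuousAt.comp hc.continuousAt)).add
        (Real.continuous_sqrt.continuousAt.smul continuousAt_const))
    simpa [ContinuousAt, hc0] using h1
  have hev : ∀ᶠ s in 𝓝[>] (0 : ℝ), f (Y * Yᵀ) ≤ f (X s) := by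
    have h1 : Tendsto (fun s => Y + normalComb A Y (c s) + √s • V) (𝓝[>] 0)
        (𝓝[{Z | ∀ i, (A i * (Z * Zᵀ)).trace = (A i * (Y * Yᵀ)).trace}] Y) := by
      refine tendsto_nhdsWithin_iff.2 ⟨hcurve.mono_left nhdsWithin_le_nhds, ?_⟩
      filter_upwards [self_mem_nhdsWithin, nhdsWithin_le_nhds hfeas] with s hs hs' i
      rw [hgram _ _ (le_of_lt hs), Matrix.mul_add, Matrix.trace_add, hs' i, Matrix.mul_smul,
        Matrix.trace_smul, smul_eq_mul, sub_add_cancel]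
    filter_upwards [self_mem_nhdsWithin, h1.eventually hmin] with s hs hs'
    rwa [hgram _ _ (le_of_lt hs)] at hs'
  have hnonneg : 0 ≤ (G * (gramDeriv Y (normalComb A Y c') + V * Vᵀ)).trace := by
    refine ge_of_tendsto hfX.tendsto_slope_zero_right ?_
    filter_upwards [self_mem_nhdsWithin, hev] with s hs hs'
    have : 0 ≤ f (X (0 + s)) - f (X 0) := by rw [hX0, zero_add]; linarith
    exact smul_nonneg (inv_nonneg.2 (le_of_lt hs)) this
  have hGY : G * Y = -∑ i, μ i • (A i * Y) := by
    rw [eq_neg_iff_add_eq_zero, ← hμ, Matrix.add_mul, Matrix.sum_mul]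
    simp
  have hval : (G * (gramDeriv Y (normalComb A Y c') + V * Vᵀ)).trace =
      ((G + ∑ i, μ i • A i) * (V * Vᵀ)).trace := by
    have h1 : 2 * ((G * Y)ᵀ * normalComb A Y c').trace = ∑ i, μ i * (A i * (V * Vᵀ)).trace := by
      rw [hGY]
      simp only [Matrix.transpose_neg, Matrix.transpose_sum, Matrix.transpose_smul,
        Matrix.neg_mul, Matrix.sum_mul, Matrix.smul_mul, Matrix.trace_neg, Matrix.trace_sum,
        Matrix.trace_smul, smul_eq_mul, mul_neg, Finset.mul_sum, ← Finset.sum_neg_distrib]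
      refine Finset.sum_congr rfl fun i _ => ?_
      linear_combination (-μ i) * hc' i
    rw [Matrix.mul_add, Matrix.trace_add, trace_mul_gramDeriv hG, h1, Matrix.add_mul,
      Matrix.trace_add, Matrix.sum_mul, Matrix.trace_sum, add_comm]
    simp
  have hww : 0 < w ⬝ᵥ w := by
    simpa using (Matrix.dotProduct_star_self_pos_iff (v := w)).2 hw
  have hquad : ((G + ∑ i, μ i • A i) * (V * Vᵀ)).trace =
      (w ⬝ᵥ w) * (star z ⬝ᵥ ((G + ∑ i, μ i • A i) *ᵥ z)) := by
    rw [hV, Matrix.transpose_vecMulVec, Matrix.vecMulVec_mul_vecMulVec, Matrix.mul_vecMulVec,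
      Matrix.trace_vecMulVec]
    simp [dotProduct_comm]
  rw [hval, hquad] at hnonneg
  exact nonneg_of_mul_nonneg_right hnonneg hww

open scoped MatrixOrder Matrix.Norms.L2Operator in
theorem Matrix.PosSemidef.trace_mul_nonneg_of_posSemidef {S X : Matrix n n ℝ}
    (hS : S.PosSemidef) (hX : X.PosSemidef) : 0 ≤ (S * X).trace := by
  classical
  obtain ⟨B, rfl⟩ := CStarAlgebra.nonneg_iff_eq_star_mul_self.1 hX.nonneg
  rw [Matrix.star_eq_conjTranspose]
  rw [← Matrix.mul_assoc, Matrix.trace_mul_comm, ← Matrix.mul_assoc]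
  exact (hS.mul_mul_conjTranspose_same B).trace_nonneg

theorem ConvexOn.add_deriv_le {E : Type*} [AddCommGroup E] [Module ℝ E] {f : E → ℝ}
    (hf : ConvexOn ℝ Set.univ f) {x y : E} {d : ℝ}
    (hd : HasDerivAt (fun t : ℝ => f (x + t • (y - x))) d 0) : f x + d ≤ f y := by
  have hconv : ConvexOn ℝ Set.univ fun t : ℝ => f (x + t • (y - x)) := by
    have h := hf.comp_affineMap (AffineMap.lineMap x y : ℝ →ᵃ[ℝ] E)
    simpa [Function.comp_def, AffineMap.lineMap_apply, add_comm] using h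
  have h := hconv.le_slope_of_hasDerivAt (Set.mem_univ 0) (Set.mem_univ 1) zero_lt_one hd
  simp only [slope_def_field, sub_zero, div_one, one_smul, zero_smul, add_zero,
    add_sub_cancel] at h
  linarith

end RankDeficientLocalMin

/-- Theorem 2: a rank-deficient local minimizer of the factorized
program yields a global minimizer `X = YYᵀ` of the convex program (P). -/
theorem rank_deficient_local_min_is_global {n p m : ℕ}
    (A : Fin m → Matrix (Fin n) (Fin n) ℝ) (b : Fin m → ℝ)
    (hA : ∀ i, (A i).IsSymm)
    (f : Matrix (Fin n) (Fin n) ℝ → ℝ)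
    (g : Matrix (Fin n) (Fin n) ℝ → Matrix (Fin n) (Fin n) ℝ)
    (hf_conv : ConvexOn ℝ Set.univ f)
    (hf : ContDiff ℝ 2 f)
    (hg_symm : ∀ X : Matrix (Fin n) (Fin n) ℝ, X.IsSymm → (g X).IsSymm)
    (hgrad : ∀ X H : Matrix (Fin n) (Fin n) ℝ,
      HasDerivAt (fun t : ℝ => f (X + t • H)) ((g X * H).trace) 0)
    (Y : Matrix (Fin n) (Fin p) ℝ)
    (hfeas : ∀ i, (Yᵀ * A i * Y).trace = b i)
    (hmin : IsLocalMinOn (fun Y' : Matrix (Fin n) (Fin p) ℝ => f (Y' * Y'ᵀ))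
      {Y' : Matrix (Fin n) (Fin p) ℝ | ∀ i, (Y'ᵀ * A i * Y').trace = b i} Y)
    (hindep : LinearIndependent ℝ (fun i => A i * Y))
    (hrank : Y.rank < p) :
    ∀ X' : Matrix (Fin n) (Fin n) ℝ, X'.PosSemidef →
      (∀ i, (A i * X').trace = b i) → f X' ≥ f (Y * Yᵀ) := by
  intro X' hX' hfeas'
  have hset : {Z : Matrix (Fin n) (Fin p) ℝ | ∀ i, (Zᵀ * A i * Z).trace = b i} =
      {Z | ∀ i, (A i * (Z * Zᵀ)).trace = (A i * (Y * Yᵀ)).trace} := by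
    ext Z
    simp only [Set.mem_ofPred_eq, ← trace_transpose_mul_mul_eq, hfeas]
  rw [hset] at hmin
  have hG : (g (Y * Yᵀ)).IsSymm := hg_symm _ (by simp [Matrix.IsSymm])
  have hD : HasStrictFDerivAt f (traceMulLeft (g (Y * Yᵀ))) (Y * Yᵀ) := by
    have h := hf.contDiffAt.hasStrictFDerivAt (x := Y * Yᵀ) two_ne_zero
    refine h.congr_fderiv ?_
    ext1 H
    exact (h.hasFDerivAt.hasLineDerivAt H).unique (hgrad _ H)
  obtain ⟨w, hw, hYw⟩ : ∃ w : Fin p → ℝ, w ≠ 0 ∧ Y *ᵥ w = 0 := by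
    by_contra! h
    have hker : LinearMap.ker Y.mulVecLin = ⊥ :=
      (Submodule.eq_bot_iff _).2 fun w hw => by_contra fun hne => h w hne hw
    have := Y.mulVecLin.finrank_range_add_finrank_ker
    rw [hker, finrank_bot, Module.finrank_fin_fun] at this
    exact hrank.ne this
  obtain ⟨μ, hμ⟩ := exists_multipliers_of_isLocalMinOn hA hG hD hmin hindep
  have hS := posSemidef_of_isLocalMinOn hA hG hD.hasFDerivAt hmin hindep hw hYw hμ
  have hconv := hf_conv.add_deriv_le (hgrad (Y * Yᵀ) (X' - Y * Yᵀ))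
  have hSX := hS.trace_mul_nonneg_of_posSemidef hX'
  have hSY : ((g (Y * Yᵀ) + ∑ i, μ i • A i) * (Y * Yᵀ)).trace = 0 := by
    rw [← Matrix.mul_assoc, hμ, Matrix.zero_mul, Matrix.trace_zero]
  have hsum : ((∑ i, μ i • A i) * X').trace = ((∑ i, μ i • A i) * (Y * Yᵀ)).trace := by
    simp only [Matrix.sum_mul, Matrix.smul_mul, Matrix.trace_sum, Matrix.trace_smul, hfeas',
      ← trace_transpose_mul_mul_eq, hfeas]
  rw [Matrix.add_mul, Matrix.trace_add] at hSX hSY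
  rw [Matrix.mul_sub, Matrix.trace_sub] at hconv
  linarith
end

section
/- Theorem 3 (projection onto the horizontal space): Assume A_i A_j = 0 for all i ≠ j (Assumption 2). Let Y ∈ ℝ^{n×p} have full column rank (so YᵀY is positive definite) and satisfy Tr(Yᵀ A_i² Y) ≠ 0 for all i. Given Z ∈ ℝ^{n×p}, let Ω ∈ ℝ^{p×p} be the (unique, skew-symmetric) solution of Ω YᵀY + YᵀY Ω = YᵀZ − ZᵀY, let α_i = Tr(Zᵀ A_i Y) / Tr(Yᵀ A_i² Y), and set P_Y(Z) = Z − Y Ω − Σ_{i=1}^m α_i A_i Y. Then P_Y(Z) belongs to the horizontal space at Y: Yᵀ P_Y(Z) = P_Y(Z)ᵀ Y and Tr(Yᵀ A_i P_Y(Z)) = 0 for all i. -/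
open Matrix BigOperators

theorem Matrix.IsSymm.trace_mul_eq_zero_of_transpose_eq_neg {ι : Type*} [Fintype ι]
    {S K : Matrix ι ι ℝ} (hS : S.IsSymm) (hK : Kᵀ = -K) : (S * K).trace = 0 := by
  have h : (S * K).trace = -(S * K).trace := by
    conv_lhs => rw [← trace_transpose, transpose_mul, hK, hS.eq, neg_mul, trace_neg, trace_mul_comm]
  linarith

theorem Matrix.IsSymm.transpose_mul_mul_same {ι κ : Type*} [Fintype ι]
    {B : Matrix ι ι ℝ} (hB : B.IsSymm) (Y : Matrix ι κ ℝ) : (Yᵀ * B * Y).IsSymm := by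
  simp [IsSymm, transpose_mul, hB.eq, Matrix.mul_assoc]

/-- Theorem 3 (projection onto the horizontal space): the matrix
`P_Y(Z) = Z − YΩ − Σ α_i A_i Y` lies in the horizontal space at `Y`. -/
theorem projection_onto_horizontal_space {n p m : ℕ}
    (A : Fin m → Matrix (Fin n) (Fin n) ℝ)
    (hA : ∀ i, (A i).IsSymm)
    (hA2 : ∀ i j, i ≠ j → A i * A j = 0)
    (Y : Matrix (Fin n) (Fin p) ℝ)
    (hY : (Yᵀ * Y).PosDef)
    (hnz : ∀ i, (Yᵀ * (A i) ^ 2 * Y).trace ≠ 0)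
    (Z : Matrix (Fin n) (Fin p) ℝ)
    (Ω : Matrix (Fin p) (Fin p) ℝ)
    (hΩ_skew : Ωᵀ = -Ω)
    (hΩ : Ω * (Yᵀ * Y) + (Yᵀ * Y) * Ω = Yᵀ * Z - Zᵀ * Y) :
    let P : Matrix (Fin n) (Fin p) ℝ :=
      Z - Y * Ω - ∑ i, ((Zᵀ * A i * Y).trace / (Yᵀ * (A i) ^ 2 * Y).trace) • (A i * Y)
    Yᵀ * P = Pᵀ * Y ∧ ∀ i, (Yᵀ * A i * P).trace = 0 := by
  intro P
  have hPY (i : Fin m) : Yᵀ * (A i * Y) = (A i * Y)ᵀ * Y := by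
    rw [transpose_mul, (hA i).eq, Matrix.mul_assoc]
  constructor
  · have hΩ' : Yᵀ * Z - Yᵀ * (Y * Ω) = Zᵀ * Y - (Y * Ω)ᵀ * Y := by
      rw [transpose_mul, hΩ_skew, Matrix.neg_mul, Matrix.neg_mul, sub_neg_eq_add, ← Matrix.mul_assoc Yᵀ Y Ω,
        Matrix.mul_assoc Ω Yᵀ Y, sub_eq_iff_eq_add, add_assoc, hΩ]
      abel
    simp only [P, Matrix.mul_sub, Matrix.sub_mul, transpose_sub, transpose_sum, transpose_smul,
      Matrix.mul_sum, Matrix.sum_mul, Matrix.mul_smul, Matrix.smul_mul, hPY, hΩ']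
  · intro i
    have hZ : (Yᵀ * A i * Z).trace = (Zᵀ * A i * Y).trace := by
      rw [← trace_transpose]
      simp [transpose_mul, (hA i).eq, Matrix.mul_assoc]
    have hYΩ : (Yᵀ * A i * (Y * Ω)).trace = 0 := by
      rw [← Matrix.mul_assoc]
      exact ((hA i).transpose_mul_mul_same Y).trace_mul_eq_zero_of_transpose_eq_neg hΩ_skew
    have hmul (j : Fin m) : Yᵀ * A i * (A j * Y) = Yᵀ * (A i * A j) * Y := by
      simp only [Matrix.mul_assoc]
    simp only [P, Matrix.mul_sub, Matrix.mul_sum, Matrix.mul_smul, trace_sub, trace_sum,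
      trace_smul, hZ, hYΩ, hmul]
    rw [Finset.sum_eq_single i (fun j _ hj => by simp [hA2 i j hj.symm]) (by simp), ← pow_two,
      smul_eq_mul, div_mul_cancel₀ _ (hnz i)]
    ring
end

section
/- Orthogonal decomposition of ℝ^{n×p} into horizontal, vertical and normal spaces: Assume A_i A_j = 0 for all i ≠ j (Assumption 2). Let Y ∈ ℝ^{n×p} have full column rank and satisfy Tr(Yᵀ A_i² Y) ≠ 0 for all i. Define H_Y = {Z ∈ ℝ^{n×p} : YᵀZ = ZᵀY and Tr(Yᵀ A_i Z) = 0 for all i}, V_Y = {Y Ω : Ω ∈ ℝ^{p×p}, Ωᵀ = −Ω}, and N_Y = span{A_1 Y, …, A_m Y}. Then H_Y, V_Y, N_Y are pairwise orthogonal with respect to the Frobenius inner product ⟨Z_1, Z_2⟩ = Tr(Z_1ᵀ Z_2), and every Z ∈ ℝ^{n×p} decomposes (uniquely) as Z = H + V + N with H ∈ H_Y, V ∈ V_Y, N ∈ N_Y. -/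
open Matrix BigOperators

section

variable {ι κ : Type*} [Fintype ι] [Fintype κ]

theorem eq_zero_of_trace_transpose_mul_self {Z : Matrix ι κ ℝ}
    (h : (Zᵀ * Z).trace = 0) : Z = 0 := by
  rw [← conjTranspose_eq_transpose_of_trivial] at h
  exact trace_conjTranspose_mul_self_eq_zero_iff.mp h

theorem trace_transpose_mul_comm (Z W : Matrix ι κ ℝ) :
    (Zᵀ * W).trace = (Wᵀ * Z).trace := by
  rw [← trace_transpose, transpose_mul, transpose_transpose]

theorem trace_symm_mul_skew {S Ω : Matrix ι ι ℝ} (hS : Sᵀ = S) (hΩ : Ωᵀ = -Ω) :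
    (S * Ω).trace = 0 := by
  have h : (S * Ω).trace = -(S * Ω).trace := by
    conv_lhs => rw [← trace_transpose, transpose_mul, hS, hΩ, Matrix.neg_mul, trace_neg,
      trace_mul_comm]
  linarith

/-- The Frobenius inner product on real matrices, as a bilinear form. -/
def frobeniusForm (ι κ : Type*) [Fintype ι] [Fintype κ] :
    LinearMap.BilinForm ℝ (Matrix ι κ ℝ) :=
  LinearMap.mk₂ ℝ (fun Z W => (Zᵀ * W).trace)
    (fun _ _ _ => by simp [Matrix.add_mul]) (fun _ _ _ => by simp)
    (fun _ _ _ => by simp [Matrix.mul_add]) (fun _ _ _ => by simp)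

theorem frobeniusForm_apply (Z W : Matrix ι κ ℝ) :
    frobeniusForm ι κ Z W = (Zᵀ * W).trace := rfl

theorem frobeniusForm_isRefl : (frobeniusForm ι κ).IsRefl := fun Z W h => by
  rwa [frobeniusForm_apply, trace_transpose_mul_comm]

theorem exists_add_frobenius_orthogonal (U : Submodule ℝ (Matrix ι κ ℝ)) (Z : Matrix ι κ ℝ) :
    ∃ W ∈ U, ∃ H : Matrix ι κ ℝ, (∀ X ∈ U, (Xᵀ * H).trace = 0) ∧ W + H = Z := by
  have hU : IsCompl U ((frobeniusForm ι κ).orthogonal U) := by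
    refine (LinearMap.BilinForm.isCompl_orthogonal_iff_disjoint frobeniusForm_isRefl).mpr ?_
    refine Submodule.disjoint_def.mpr fun X hX hX' => ?_
    exact eq_zero_of_trace_transpose_mul_self (hX' X hX)
  obtain ⟨W, hW, H, hH, h⟩ := Submodule.mem_sup.mp (hU.sup_eq_top ▸ Submodule.mem_top (x := Z))
  exact ⟨W, hW, H, hH, h⟩

theorem eq_zero_of_orthogonal_sum {P Q R : Matrix ι κ ℝ} (hPQ : (Pᵀ * Q).trace = 0)
    (hPR : (Pᵀ * R).trace = 0) (h : P + Q + R = 0) : P = 0 := by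
  apply eq_zero_of_trace_transpose_mul_self
  have := congrArg (fun X => (Pᵀ * X).trace) h
  simpa [Matrix.mul_add, hPQ, hPR] using this

/-- Three pairwise orthogonal subspaces, the first of which contains everything orthogonal to
the other two, give a unique decomposition. -/
theorem existsUnique_orthogonal_decomposition {P Q R : Submodule ℝ (Matrix ι κ ℝ)}
    (hPQ : ∀ X ∈ P, ∀ W ∈ Q, (Xᵀ * W).trace = 0)
    (hPR : ∀ X ∈ P, ∀ W ∈ R, (Xᵀ * W).trace = 0)
    (hQR : ∀ X ∈ Q, ∀ W ∈ R, (Xᵀ * W).trace = 0)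
    (hP : ∀ Z, (∀ X ∈ Q, (Xᵀ * Z).trace = 0) → (∀ X ∈ R, (Xᵀ * Z).trace = 0) → Z ∈ P)
    (Z : Matrix ι κ ℝ) :
    ∃! T : Matrix ι κ ℝ × Matrix ι κ ℝ × Matrix ι κ ℝ,
      T.1 ∈ P ∧ T.2.1 ∈ Q ∧ T.2.2 ∈ R ∧ Z = T.1 + T.2.1 + T.2.2 := by
  obtain ⟨W, hW, H, hH, rfl⟩ := exists_add_frobenius_orthogonal (Q ⊔ R) Z
  obtain ⟨V, hV, N, hN, rfl⟩ := Submodule.mem_sup.mp hW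
  have hHP : H ∈ P := hP H (fun X hX => hH X (Submodule.mem_sup_left hX))
    fun X hX => hH X (Submodule.mem_sup_right hX)
  refine ⟨(H, V, N), ⟨hHP, hV, hN, by simp only; abel⟩, ?_⟩
  rintro ⟨H', V', N'⟩ ⟨hH', hV', hN', h⟩
  simp only at hH' hV' hN' h
  have hsum : (H' - H) + (V' - V) + (N' - N) = 0 := by
    rw [← sub_eq_zero.mpr h.symm]; abel
  have dH := P.sub_mem hH' hHP
  have dV := Q.sub_mem hV' hV
  have dN := R.sub_mem hN' hN
  have eH := eq_zero_of_orthogonal_sum (hPQ _ dH _ dV) (hPR _ dH _ dN) hsum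
  have eV := eq_zero_of_orthogonal_sum (hQR _ dV _ dN)
    (by rw [trace_transpose_mul_comm]; exact hPQ _ dH _ dV)
    (show (V' - V) + (N' - N) + (H' - H) = 0 by rw [← hsum]; abel)
  rw [eH, eV, zero_add, zero_add] at hsum
  rw [sub_eq_zero.mp eH, sub_eq_zero.mp eV, sub_eq_zero.mp hsum]

/-- Matrices `Z` with `YᵀZ` symmetric that are tangent to the constraints `Tr(Yᵀ A i Y) = b i`. -/
def horizontalSpace {η : Type*} (A : η → Matrix ι ι ℝ) (Y : Matrix ι κ ℝ) :
    Submodule ℝ (Matrix ι κ ℝ) where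
  carrier := {Z | Yᵀ * Z = Zᵀ * Y ∧ ∀ i, (Yᵀ * A i * Z).trace = 0}
  add_mem' := fun ⟨h₁, h₂⟩ ⟨k₁, k₂⟩ =>
    ⟨by rw [Matrix.mul_add, h₁, k₁, transpose_add, Matrix.add_mul],
      fun i => by rw [Matrix.mul_add, trace_add, h₂, k₂, add_zero]⟩
  zero_mem' := by simp
  smul_mem' := fun c Z ⟨h₁, h₂⟩ => ⟨by simp [h₁], fun i => by simp [h₂]⟩

/-- The tangent space at `Y` of its orbit under right multiplication by orthogonal matrices. -/
def verticalSpace (Y : Matrix ι κ ℝ) : Submodule ℝ (Matrix ι κ ℝ) where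
  carrier := {Z | ∃ Ω : Matrix κ κ ℝ, Ωᵀ = -Ω ∧ Z = Y * Ω}
  add_mem' := by
    rintro _ _ ⟨Ω, h, rfl⟩ ⟨Ω', h', rfl⟩
    exact ⟨Ω + Ω', by rw [transpose_add, h, h', neg_add], by rw [Matrix.mul_add]⟩
  zero_mem' := ⟨0, by simp, by simp⟩
  smul_mem' := by
    rintro c _ ⟨Ω, h, rfl⟩
    exact ⟨c • Ω, by rw [transpose_smul, h, smul_neg], by rw [Matrix.mul_smul]⟩

theorem trace_transpose_mul_eq_zero_of_mem_span {X : Matrix ι κ ℝ} {s : Set (Matrix ι κ ℝ)}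
    (h : ∀ W ∈ s, (Xᵀ * W).trace = 0) {N : Matrix ι κ ℝ} (hN : N ∈ Submodule.span ℝ s) :
    (Xᵀ * N).trace = 0 :=
  (Submodule.span_le (p := LinearMap.ker (frobeniusForm ι κ X))).mpr h hN

end

/-- Orthogonal decomposition of `ℝ^{n×p}` into the horizontal,
vertical and normal spaces at a full-column-rank feasible point `Y`. -/
theorem horizontal_vertical_normal_decomposition {n p m : ℕ}
    (A : Fin m → Matrix (Fin n) (Fin n) ℝ)
    (hA : ∀ i, (A i).IsSymm)
    (hA2 : ∀ i j, i ≠ j → A i * A j = 0)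
    (Y : Matrix (Fin n) (Fin p) ℝ)
    (hY : Y.rank = p)
    (hnz : ∀ i, (Yᵀ * (A i) ^ 2 * Y).trace ≠ 0) :
    let HY : Set (Matrix (Fin n) (Fin p) ℝ) :=
      {Z | Yᵀ * Z = Zᵀ * Y ∧ ∀ i, (Yᵀ * A i * Z).trace = 0}
    let VY : Set (Matrix (Fin n) (Fin p) ℝ) :=
      {Z | ∃ Ω : Matrix (Fin p) (Fin p) ℝ, Ωᵀ = -Ω ∧ Z = Y * Ω}
    let NY : Set (Matrix (Fin n) (Fin p) ℝ) :=
      ↑(Submodule.span ℝ (Set.range fun i => A i * Y))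
    (∀ H ∈ HY, ∀ V ∈ VY, (Hᵀ * V).trace = 0) ∧
    (∀ H ∈ HY, ∀ N ∈ NY, (Hᵀ * N).trace = 0) ∧
    (∀ V ∈ VY, ∀ N ∈ NY, (Vᵀ * N).trace = 0) ∧
    ∀ Z : Matrix (Fin n) (Fin p) ℝ,
      ∃! T : Matrix (Fin n) (Fin p) ℝ × Matrix (Fin n) (Fin p) ℝ ×
          Matrix (Fin n) (Fin p) ℝ,
        T.1 ∈ HY ∧ T.2.1 ∈ VY ∧ T.2.2 ∈ NY ∧ Z = T.1 + T.2.1 + T.2.2 := by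
  intro HY VY NY
  have trace_normal : ∀ i (Z : Matrix (Fin n) (Fin p) ℝ),
      ((A i * Y)ᵀ * Z).trace = (Yᵀ * A i * Z).trace := fun i Z => by
    rw [transpose_mul, (hA i).eq]
  have hHV : ∀ H ∈ HY, ∀ V ∈ VY, (Hᵀ * V).trace = 0 := by
    rintro H ⟨hH, -⟩ _ ⟨Ω, hΩ, rfl⟩
    rw [← Matrix.mul_assoc]
    exact trace_symm_mul_skew (by rw [transpose_mul, transpose_transpose, hH]) hΩ
  have hHN : ∀ H ∈ HY, ∀ N ∈ NY, (Hᵀ * N).trace = 0 := by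
    rintro H ⟨-, hH⟩ N hN
    refine trace_transpose_mul_eq_zero_of_mem_span ?_ hN
    rintro _ ⟨i, rfl⟩
    beta_reduce
    rw [trace_transpose_mul_comm, trace_normal, hH]
  have hVN : ∀ V ∈ VY, ∀ N ∈ NY, (Vᵀ * N).trace = 0 := by
    rintro _ ⟨Ω, hΩ, rfl⟩ N hN
    refine trace_transpose_mul_eq_zero_of_mem_span ?_ hN
    rintro _ ⟨i, rfl⟩
    beta_reduce
    rw [trace_transpose_mul_comm, trace_normal, ← Matrix.mul_assoc]
    refine trace_symm_mul_skew ?_ hΩ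
    rw [transpose_mul, transpose_mul, transpose_transpose, (hA i).eq, Matrix.mul_assoc]
  refine ⟨hHV, hHN, hVN, existsUnique_orthogonal_decomposition (P := horizontalSpace A Y)
    (Q := verticalSpace Y) hHV hHN hVN fun Z hV hN => ⟨?_, fun i => ?_⟩⟩
  · have hΩ : (Yᵀ * Z - Zᵀ * Y)ᵀ = -(Yᵀ * Z - Zᵀ * Y) := by simp
    have h := hV (Y * (Yᵀ * Z - Zᵀ * Y)) ⟨_, hΩ, rfl⟩
    have h' := h
    rw [trace_transpose_mul_comm, ← Matrix.mul_assoc, trace_mul_comm] at h'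
    rw [transpose_mul, Matrix.mul_assoc, hΩ, Matrix.neg_mul, trace_neg, neg_eq_zero] at h
    refine sub_eq_zero.mp (eq_zero_of_trace_transpose_mul_self ?_)
    rw [hΩ, Matrix.neg_mul, Matrix.mul_sub, trace_neg, trace_sub, h, h', sub_zero, neg_zero]
  · rw [← trace_normal]
    exact hN _ (Submodule.subset_span ⟨i, rfl⟩)
end

section
/- Feasibility of the retraction under Assumption 2: Assume A_i A_j = 0 for all i ≠ j, with each A_i symmetric. Let Ỹ ∈ ℝ^{n×p}, α ∈ ℝ^m, and set Ȳ = Ỹ + Σ_{i=1}^m α_i A_i Ỹ. Then for every j = 1,…,m, Tr(Ȳᵀ A_j Ȳ) = Tr(Ỹᵀ A_j Ỹ) + 2 α_j Tr(Ỹᵀ A_j² Ỹ) + α_j² Tr(Ỹᵀ A_j³ Ỹ). In particular, if each α_j solves the quadratic equation α_j² Tr(Ỹᵀ A_j³ Ỹ) + 2 α_j Tr(Ỹᵀ A_j² Ỹ) + Tr(Ỹᵀ A_j Ỹ) = b_j, then Ȳ satisfies the constraints Tr(Ȳᵀ A_j Ȳ) = b_j for all j. -/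
open Matrix BigOperators

/-- Multiplying the retracted point by `A j` only sees the `j`-th correction term. -/
theorem mul_add_sum_smul_mul_of_mul_eq_zero {ι n p R : Type*} [Fintype ι] [Fintype n]
    [CommRing R] (A : ι → Matrix n n R) (hA : ∀ i j, i ≠ j → A i * A j = 0)
    (Y : Matrix n p R) (α : ι → R) (j : ι) :
    A j * (Y + ∑ i, α i • (A i * Y)) = A j * Y + α j • (A j * (A j * Y)) := by
  rw [Matrix.mul_add, Matrix.mul_sum, Finset.sum_eq_single j]
  · rw [Matrix.mul_smul]
  · intro i _ hij
    rw [Matrix.mul_smul, ← Matrix.mul_assoc, hA j i hij.symm, Matrix.zero_mul, smul_zero]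
  · simp

/-- Feasibility of the retraction under Assumption 2: the
constraint values at `Ȳ = Ỹ + Σ α_i A_i Ỹ` are quadratic polynomials in the
coefficients `α_j`, so solving the quadratics restores feasibility. -/
theorem retraction_feasibility {n p m : ℕ}
    (A : Fin m → Matrix (Fin n) (Fin n) ℝ) (b : Fin m → ℝ)
    (hA : ∀ i, (A i).IsSymm)
    (hA2 : ∀ i j, i ≠ j → A i * A j = 0)
    (Yt : Matrix (Fin n) (Fin p) ℝ) (α : Fin m → ℝ) :
    let Yb : Matrix (Fin n) (Fin p) ℝ := Yt + ∑ i, α i • (A i * Yt)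
    (∀ j, (Ybᵀ * A j * Yb).trace =
        (Ytᵀ * A j * Yt).trace + 2 * α j * (Ytᵀ * (A j) ^ 2 * Yt).trace
          + (α j) ^ 2 * (Ytᵀ * (A j) ^ 3 * Yt).trace) ∧
    ((∀ j, (α j) ^ 2 * (Ytᵀ * (A j) ^ 3 * Yt).trace
        + 2 * α j * (Ytᵀ * (A j) ^ 2 * Yt).trace
        + (Ytᵀ * A j * Yt).trace = b j) →
      ∀ j, (Ybᵀ * A j * Yb).trace = b j) := by
  intro Yb
  have key : ∀ j, (Ybᵀ * A j * Yb).trace =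
      (Ytᵀ * A j * Yt).trace + 2 * α j * (Ytᵀ * (A j) ^ 2 * Yt).trace
        + (α j) ^ 2 * (Ytᵀ * (A j) ^ 3 * Yt).trace := by
    intro j
    have hr : A j * Yb = A j * Yt + α j • (A j * (A j * Yt)) :=
      mul_add_sum_smul_mul_of_mul_eq_zero A hA2 Yt α j
    have hl : Ybᵀ * A j = Ytᵀ * A j + α j • (Ytᵀ * A j * A j) := by
      simpa [Matrix.transpose_mul, (hA j).eq] using congrArg Matrix.transpose hr
    have hY : Ybᵀ * A j * Yb =
        (Ytᵀ * A j + α j • (Ytᵀ * A j * A j)) * (Yt + α j • (A j * Yt)) := by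
      rw [← hl, Matrix.mul_assoc, Matrix.mul_assoc, hr, Matrix.mul_add (A j), Matrix.mul_smul]
    rw [hY]
    simp only [Matrix.add_mul, Matrix.mul_add, Matrix.smul_mul, Matrix.mul_smul,
      Matrix.trace_add, Matrix.trace_smul, smul_eq_mul, pow_succ, pow_zero, one_mul,
      Matrix.mul_assoc]
    ring
  refine ⟨key, fun h j => ?_⟩
  rw [key j, ← h j]
  ring
end

section
/- Agreement of the convex and concave sparse-PCA costs on rank-one matrices: Let z ∈ ℝ^m with zᵀz = 1, let a ∈ ℝ^m, and let ρ ∈ ℝ. Set Z = z zᵀ (so Z is positive semidefinite with Z^{1/2} = Z). Then the sum of the positive eigenvalues of the symmetric matrix Z^{1/2} (a aᵀ − ρ I) Z^{1/2} = (z zᵀ)(a aᵀ − ρ I)(z zᵀ) equals max((aᵀ z)² − ρ, 0). Consequently, for a data matrix with columns a_1,…,a_n, the concave function f_ccv(Z) = Σ_{i=1}^n Tr(Z^{1/2}(a_i a_iᵀ − ρ I)Z^{1/2})₊ and the convex function f_cvx(Z) = Σ_{i=1}^n (a_iᵀ Z a_i − ρ)₊ both equal Σ_{i=1}^n ((a_iᵀ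 z)² − ρ)₊ at Z = z zᵀ. -/
open Matrix BigOperators

section RankOne

variable {n : Type*} [Fintype n]

namespace Matrix.IsHermitian

variable [DecidableEq n] {A : Matrix n n ℝ} {c : ℝ}

/-- If `A * A = c • A`, then every eigenvalue of the symmetric matrix `A` is `0` or `c`. -/
theorem eigenvalues_eq_zero_or_eq_of_mul_self_eq_smul (hA : A.IsHermitian) (h : A * A = c • A)
    (j : n) : hA.eigenvalues j = 0 ∨ hA.eigenvalues j = c := by
  have hv := hA.mulVec_eigenvectorBasis j
  have hne : (hA.eigenvectorBasis j).ofLp ≠ 0 := fun h0 =>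
    hA.eigenvectorBasis.orthonormal.ne_zero j (by ext i; exact congrFun h0 i)
  have key := congrArg (· *ᵥ (hA.eigenvectorBasis j).ofLp) h
  simp only [← mulVec_mulVec, smul_mulVec, hv, mulVec_smul, smul_smul] at key
  have hmul := smul_left_injective ℝ hne key
  simp only [mul_eq_mul_right_iff] at hmul
  exact hmul.symm

/-- The sum of the positive eigenvalues of a symmetric matrix `A` with `A * A = c • A` and
trace `c` is the positive part of `c`. -/
theorem sum_max_eigenvalues_zero_of_mul_self_eq_smul (hA : A.IsHermitian) (h : A * A = c • A)
    (htr : A.trace = c) : ∑ j, max (hA.eigenvalues j) 0 = max c 0 := by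
  have heig := hA.eigenvalues_eq_zero_or_eq_of_mul_self_eq_smul h
  rcases le_total 0 c with hc | hc
  · rw [max_eq_left hc]
    calc ∑ j, max (hA.eigenvalues j) 0 = ∑ j, hA.eigenvalues j :=
          Finset.sum_congr rfl fun j _ => max_eq_left <| by
            rcases heig j with hj | hj <;> rw [hj]
            exact hc
      _ = c := by simpa [htr] using hA.trace_eq_sum_eigenvalues.symm
  · rw [max_eq_right hc]
    refine Finset.sum_eq_zero fun j _ => max_eq_right ?_
    rcases heig j with hj | hj <;> rw [hj]
    exact hc

end Matrix.IsHermitian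

theorem Matrix.dotProduct_vecMulVec_self_mulVec (z a : n → ℝ) :
    a ⬝ᵥ (vecMulVec z z *ᵥ a) = (a ⬝ᵥ z) ^ 2 := by
  simp [vecMulVec_mulVec, dotProduct_comm z a, sq]

/-- Compressing a matrix by `z zᵀ` gives the multiple `zᵀ B z` of `z zᵀ`. -/
theorem Matrix.vecMulVec_self_mul_mul_vecMulVec_self (z : n → ℝ) (B : Matrix n n ℝ) :
    vecMulVec z z * B * vecMulVec z z = (z ⬝ᵥ (B *ᵥ z)) • vecMulVec z z := by
  rw [Matrix.mul_assoc, mul_vecMulVec, vecMulVec_mul_vecMulVec, vecMulVec_smul]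

end RankOne

/-- Agreement of the convex and concave sparse-PCA costs on
rank-one matrices `Z = z zᵀ` with `zᵀz = 1`: the sum of the positive
eigenvalues of `(z zᵀ)(a aᵀ − ρ I)(z zᵀ)` equals `((aᵀz)² − ρ)₊`, so both
`f_ccv` and `f_cvx` reduce to `Σ_i ((a_iᵀ z)² − ρ)₊` at `Z = z zᵀ`. -/
theorem sparse_pca_costs_agree_on_rank_one {m N : ℕ}
    (z : Fin m → ℝ) (hz : z ⬝ᵥ z = 1) (ρ : ℝ)
    (hHerm : ∀ a : Fin m → ℝ,
      (vecMulVec z z * (vecMulVec a a - ρ • (1 : Matrix (Fin m) (Fin m) ℝ)) *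
        vecMulVec z z).IsHermitian)
    (a : Fin N → Fin m → ℝ) :
    (∀ a' : Fin m → ℝ,
      (∑ j, max ((hHerm a').eigenvalues j) 0) = max ((a' ⬝ᵥ z) ^ 2 - ρ) 0) ∧
    (∑ i, ∑ j, max ((hHerm (a i)).eigenvalues j) 0)
      = ∑ i, max ((a i ⬝ᵥ z) ^ 2 - ρ) 0 ∧
    (∑ i, max ((a i) ⬝ᵥ (vecMulVec z z *ᵥ a i) - ρ) 0)
      = ∑ i, max ((a i ⬝ᵥ z) ^ 2 - ρ) 0 := by
  have hpos : ∀ a' : Fin m → ℝ,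
      (∑ j, max ((hHerm a').eigenvalues j) 0) = max ((a' ⬝ᵥ z) ^ 2 - ρ) 0 := by
    intro a'
    have hB : z ⬝ᵥ ((vecMulVec a' a' - ρ • (1 : Matrix (Fin m) (Fin m) ℝ)) *ᵥ z)
        = (a' ⬝ᵥ z) ^ 2 - ρ := by
      rw [sub_mulVec, dotProduct_sub, dotProduct_vecMulVec_self_mulVec, smul_mulVec, one_mulVec,
        dotProduct_smul, hz, smul_eq_mul, mul_one, dotProduct_comm z a']
    have hM := vecMulVec_self_mul_mul_vecMulVec_self z
      (vecMulVec a' a' - ρ • (1 : Matrix (Fin m) (Fin m) ℝ))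
    rw [hB] at hM
    apply (hHerm a').sum_max_eigenvalues_zero_of_mul_self_eq_smul
    · rw [hM, smul_mul_smul_comm, vecMulVec_mul_vecMulVec, hz, one_smul, mul_smul]
    · rw [hM, trace_smul, trace_vecMulVec, hz, smul_eq_mul, mul_one]
  exact ⟨hpos, Finset.sum_congr rfl fun i _ => hpos (a i),
    Finset.sum_congr rfl fun i _ => by rw [dotProduct_vecMulVec_self_mulVec]⟩
end
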